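/- There exists a real number p₀ such that for every prime p ≥ p₀, if there exist positive integers m and n with m² ∣ p + 2, n² ∣ p − 2, m > (log p)² and n > (log p)², then p does not divide the class number of ℚ(√(−p(p+2))), p does not divide the class number of ℚ(√(−p(p−2))), and p does not divide the class number of ℚ(√(−(p+2)(p−2))). -/

import Mathlib

/-- `p` does not divide the class number of `ℚ(√-N)`: for every number field `K` generated
over `ℚ` by an element `α` with `α² = -N`, `p` does not divide the class number of `K`. -/
def NotDvdClassNumberSqrtNeg (p N : ℕ) : Prop :=
  ∀ (K : Type) [Field K] [NumberField K] (α : K),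
    α ^ 2 = -(N : K) → Algebra.adjoin ℚ {α} = ⊤ → ¬ p ∣ NumberField.classNumber K

/-- Multisets supported on a set of elements whose weights are pairwise coprime and not `1`
are determined by the product of their weights. -/
theorem Multiset.eq_of_prod_map_eq_of_coprime {ι : Type*} (N : ι → ℕ) (T : Set ι)
    (hzero : ∀ P ∈ T, N P ≠ 0) (hone : ∀ P ∈ T, N P ≠ 1)
    (hT : ∀ P ∈ T, ∀ Q ∈ T, ¬ (N P).Coprime (N Q) → P = Q) {s t : Multiset ι}
    (hs : ∀ P ∈ s, P ∈ T) (ht : ∀ P ∈ t, P ∈ T) (h : (s.map N).prod = (t.map N).prod) :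
    s = t := by
  induction s using Multiset.induction_on generalizing t with
  | empty =>
    symm
    refine Multiset.eq_zero_of_forall_notMem fun P hP ↦ hone P (ht P hP) ?_
    have := Multiset.dvd_prod (Multiset.mem_map_of_mem N hP)
    rw [← h] at this
    simpa using this
  | cons P s ih =>
    have hPT := hs P (Multiset.mem_cons_self P s)
    have hdvd : N P ∣ (t.map N).prod := by
      rw [← h, Multiset.map_cons, Multiset.prod_cons]
      exact dvd_mul_right _ _
    have hPt : P ∈ t := by
      by_contra hPt
      refine hone P hPT (Nat.Coprime.eq_one_of_dvd ?_ hdvd)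
      refine Nat.coprime_multiset_prod_right_iff.2 fun n hn ↦ ?_
      obtain ⟨Q, hQ, rfl⟩ := Multiset.mem_map.1 hn
      by_contra hPQ
      exact hPt (hT P hPT Q (ht Q hQ) hPQ ▸ hQ)
    obtain ⟨u, rfl⟩ := Multiset.exists_cons_of_mem hPt
    rw [Multiset.map_cons, Multiset.prod_cons, Multiset.map_cons, Multiset.prod_cons] at h
    rw [ih (fun Q hQ ↦ hs Q (Multiset.mem_cons_of_mem hQ))
      (fun Q hQ ↦ ht Q (Multiset.mem_cons_of_mem hQ))
      (Nat.eq_of_mul_eq_mul_left (Nat.pos_of_ne_zero (hzero P hPT)) h)]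

/-- There are at most `n (1 + log n)` pairs of positive integers whose product is at most `n`. -/
theorem Nat.card_sigma_Icc_div_le (n : ℕ) :
    (((Finset.Icc 1 n).sigma fun a ↦ Finset.Icc 1 (n / a)).card : ℝ) ≤
      n * (1 + Real.log n) := by
  have h : (((Finset.Icc 1 n).sigma fun a ↦ Finset.Icc 1 (n / a)).card : ℝ) ≤
      n * (harmonic n : ℝ) := by
    rw [Finset.card_sigma, harmonic_eq_sum_Icc]
    push_cast
    rw [Finset.mul_sum]
    refine Finset.sum_le_sum fun a _ ↦ ?_
    simpa [div_eq_mul_inv] using (Nat.cast_div_le : ((n / a : ℕ) : ℝ) ≤ n / a)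
  exact h.trans (by gcongr; exact harmonic_le_one_add_log n)

open Module

open scoped nonZeroDivisors NumberField

namespace NumberField

variable {K : Type*} [Field K] [NumberField K]

theorem exists_prime_absNorm_eq_pow {P : Ideal (𝓞 K)} (hP : Prime P) :
    ∃ l k : ℕ, 0 < k ∧ (l : 𝓞 K) ∈ P ∧ l.Prime ∧ P.absNorm = l ^ k := by
  have : P.IsMaximal := (Ideal.isPrime_of_prime hP).isMaximal hP.ne_zero
  exact Ideal.exists_prime_and_absNorm_eq_pow P

/-- In a quadratic field at most two primes lie above a given rational prime. -/
theorem not_injective_of_forall_dvd_absNorm (hK : finrank ℚ K = 2) {q : ℕ} (hq : q.Prime)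
    {P : Fin 3 → Ideal (𝓞 K)} (hP : ∀ i, Prime (P i)) (hqN : ∀ i, q ∣ (P i).absNorm) :
    ¬ Function.Injective P := by
  intro hinj
  have hqP : ∀ i, (q : 𝓞 K) ∈ P i := fun i ↦ by
    obtain ⟨l, k, -, hl, hlp, h⟩ := exists_prime_absNorm_eq_pow (hP i)
    rwa [(Nat.prime_dvd_prime_iff_eq hq hlp).1 (hq.dvd_of_dvd_pow (h ▸ hqN i))]
  have hdvd : ∏ i, P i ∣ Ideal.span {(q : 𝓞 K)} := by
    have := Finset.prod_primes_dvd (s := Finset.univ.image P) (Ideal.span {(q : 𝓞 K)})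
      (by simpa using hP) (by simpa [Ideal.dvd_span_singleton] using hqP)
    rwa [Finset.prod_image (fun i _ j _ h ↦ hinj h)] at this
  have hN := map_dvd Ideal.absNorm hdvd
  rw [Ideal.absNorm_span_natCast, RingOfIntegers.rank, hK, map_prod] at hN
  have h3 : q ^ 3 ∣ q ^ 2 := by
    have := Finset.prod_dvd_prod_of_dvd (s := Finset.univ) (fun _ ↦ q) _ fun i _ ↦ hqN i
    rw [Finset.prod_const, Finset.card_univ, Fintype.card_fin] at this
    exact this.trans hN
  have := (Nat.pow_dvd_pow_iff_le_right hq.one_lt).1 h3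
  omega

/-- The primes of a quadratic field split into two classes, each of which contains at most one
prime above each rational prime. -/
theorem exists_set_eq_of_not_coprime_absNorm (hK : finrank ℚ K = 2) :
    ∃ S : Set (Ideal (𝓞 K)),
      (∀ P Q, Prime P → Prime Q → P ∈ S → Q ∈ S →
        ¬ P.absNorm.Coprime Q.absNorm → P = Q) ∧
      (∀ P Q, Prime P → Prime Q → P ∉ S → Q ∉ S →
        ¬ P.absNorm.Coprime Q.absNorm → P = Q) := by
  have hR : ∀ q : ℕ, ∃ R : Ideal (𝓞 K), ∀ P : Ideal (𝓞 K), Prime P → q ∣ P.absNorm →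
      Prime R ∧ q ∣ R.absNorm := fun q ↦ by
    by_cases h : ∃ R : Ideal (𝓞 K), Prime R ∧ q ∣ R.absNorm
    · exact ⟨h.choose, fun _ _ _ ↦ h.choose_spec⟩
    · exact ⟨⊥, fun P hP hq ↦ absurd ⟨P, hP, hq⟩ h⟩
  choose R hR using hR
  have key : ∀ P Q : Ideal (𝓞 K), Prime P → Prime Q → ¬ P.absNorm.Coprime Q.absNorm →
      P.absNorm.minFac = Q.absNorm.minFac ∧ P.absNorm.minFac.Prime := by
    intro P Q hP hQ h
    obtain ⟨l, k, hk, -, hl, hPl⟩ := exists_prime_absNorm_eq_pow hP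
    obtain ⟨r, j, hj, -, hr, hQl⟩ := exists_prime_absNorm_eq_pow hQ
    rw [hPl, hQl, hl.pow_minFac hk.ne', hr.pow_minFac hj.ne']
    refine ⟨?_, hl⟩
    by_contra hne
    exact h (hPl ▸ hQl ▸ Nat.Coprime.pow k j ((Nat.coprime_primes hl hr).2 hne))
  refine ⟨{P | P = R P.absNorm.minFac}, fun P Q hP hQ hPS hQS h ↦ ?_,
    fun P Q hP hQ hPS hQS h ↦ ?_⟩
  · rw [Set.mem_ofPred_eq] at hPS hQS
    rw [hPS, hQS, (key P Q hP hQ h).1]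
  · obtain ⟨hPQ, hq⟩ := key P Q hP hQ h
    rw [Set.mem_ofPred_eq] at hPS hQS
    rw [← hPQ] at hQS
    obtain ⟨hRp, hRd⟩ := hR _ P hP (Nat.minFac_dvd _)
    by_contra hne
    refine not_injective_of_forall_dvd_absNorm hK hq (P := ![P, Q, R P.absNorm.minFac]) ?_ ?_ ?_
    · simp [Fin.forall_fin_succ, hP, hQ, hRp]
    · simp only [Fin.forall_fin_succ]
      exact ⟨Nat.minFac_dvd _, hPQ ▸ Nat.minFac_dvd _, hRd, fun i ↦ i.elim0⟩
    · intro i j hij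
      fin_cases i <;> fin_cases j <;> simp_all [eq_comm]

/-- Every ideal class of a quadratic field contains an ideal of norm at most `√|discr K|`. -/
theorem exists_ideal_in_class_of_norm_le_of_finrank_eq_two (hK : finrank ℚ K = 2)
    (C : ClassGroup (𝓞 K)) :
    ∃ I : (Ideal (𝓞 K))⁰, ClassGroup.mk0 I = C ∧
      ((I : Ideal (𝓞 K)).absNorm : ℝ) ≤ √|(discr K : ℝ)| := by
  obtain ⟨I, hI, h⟩ := exists_ideal_in_class_of_norm_le C
  refine ⟨I, hI, h.trans ?_⟩
  have hle : InfinitePlace.nrComplexPlaces K ≤ 1 := by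
    have := InfinitePlace.card_add_two_mul_card_eq_rank K
    omega
  have hpi : (4 / Real.pi) ^ InfinitePlace.nrComplexPlaces K ≤ 2 := by
    have h1 : 1 ≤ 4 / Real.pi := (one_le_div Real.pi_pos).2 Real.pi_le_four
    refine (pow_le_pow_right₀ h1 hle).trans ?_
    rw [pow_one, div_le_iff₀ Real.pi_pos]
    linarith [Real.pi_gt_three]
  rw [hK]
  have := Real.sqrt_nonneg |(discr K : ℝ)|
  norm_num [Nat.factorial]
  nlinarith

/-- The class number of a quadratic field is at most `X (1 + log X)` for `X ≥ √|discr K|`. -/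
theorem classNumber_le_of_finrank_eq_two (hK : finrank ℚ K = 2) {X : ℝ}
    (hX : √|(discr K : ℝ)| ≤ X) : (classNumber K : ℝ) ≤ X * (1 + Real.log X) := by
  classical
  obtain ⟨S, hS, hS'⟩ := exists_set_eq_of_not_coprime_absNorm hK
  choose I hIC hI using exists_ideal_in_class_of_norm_le_of_finrank_eq_two hK
  have hI0 : ∀ C, (I C : Ideal (𝓞 K)) ≠ 0 := fun C ↦ nonZeroDivisors.coe_ne_zero _
  let F : ClassGroup (𝓞 K) → Multiset (Ideal (𝓞 K)) := fun C ↦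
    UniqueFactorizationMonoid.normalizedFactors (I C : Ideal (𝓞 K))
  have hF : ∀ C, ∀ P ∈ F C, Prime P := fun C P hP ↦
    UniqueFactorizationMonoid.prime_of_normalized_factor P hP
  let a : ClassGroup (𝓞 K) → ℕ := fun C ↦ (((F C).filter (· ∈ S)).map Ideal.absNorm).prod
  let b : ClassGroup (𝓞 K) → ℕ := fun C ↦ (((F C).filter (· ∉ S)).map Ideal.absNorm).prod
  have hab : ∀ C, a C * b C = (I C : Ideal (𝓞 K)).absNorm := fun C ↦ by
    rw [← Multiset.prod_add, ← Multiset.map_add, Multiset.filter_add_not, ← map_multiset_prod,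
      Ideal.prod_normalizedFactors_eq_self (hI0 C)]
  have hpos : ∀ C, 0 < a C * b C := fun C ↦ by
    rw [hab]
    exact Ideal.absNorm_pos_of_nonZeroDivisors _
  set n := ⌊X⌋₊
  have hle : ∀ C, a C * b C ≤ n := fun C ↦ by
    rw [hab]
    exact Nat.le_floor ((hI C).trans hX)
  have hinj : Function.Injective fun C ↦ (⟨a C, b C⟩ : Σ _ : ℕ, ℕ) := by
    intro C D hCD
    have hzero : ∀ P : Ideal (𝓞 K), Prime P → P.absNorm ≠ 0 := fun P hP ↦
      Ideal.absNorm_eq_zero_iff.not.2 hP.ne_zero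
    have hone : ∀ P : Ideal (𝓞 K), Prime P → P.absNorm ≠ 1 := fun P hP h ↦
      hP.not_isUnit (Ideal.isUnit_iff.2 (Ideal.absNorm_eq_one_iff.1 h))
    obtain ⟨ha, hb⟩ : a C = a D ∧ b C = b D := by simpa using hCD
    have h₁ : (F C).filter (· ∈ S) = (F D).filter (· ∈ S) :=
      Multiset.eq_of_prod_map_eq_of_coprime Ideal.absNorm {P | Prime P ∧ P ∈ S}
        (fun P hP ↦ hzero P hP.1) (fun P hP ↦ hone P hP.1)
        (fun P hP Q hQ ↦ hS P Q hP.1 hQ.1 hP.2 hQ.2)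
        (fun P hP ↦ ⟨hF C P (Multiset.mem_filter.1 hP).1, (Multiset.mem_filter.1 hP).2⟩)
        (fun P hP ↦ ⟨hF D P (Multiset.mem_filter.1 hP).1, (Multiset.mem_filter.1 hP).2⟩) ha
    have h₂ : (F C).filter (· ∉ S) = (F D).filter (· ∉ S) :=
      Multiset.eq_of_prod_map_eq_of_coprime Ideal.absNorm {P | Prime P ∧ P ∉ S}
        (fun P hP ↦ hzero P hP.1) (fun P hP ↦ hone P hP.1)
        (fun P hP Q hQ ↦ hS' P Q hP.1 hQ.1 hP.2 hQ.2)
        (fun P hP ↦ ⟨hF C P (Multiset.mem_filter.1 hP).1, (Multiset.mem_filter.1 hP).2⟩)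
        (fun P hP ↦ ⟨hF D P (Multiset.mem_filter.1 hP).1, (Multiset.mem_filter.1 hP).2⟩) hb
    have hFCD : F C = F D := by
      rw [← Multiset.filter_add_not (· ∈ S) (F C), h₁, h₂, Multiset.filter_add_not]
    have hICD : I C = I D := by
      apply Subtype.ext
      rw [← Ideal.prod_normalizedFactors_eq_self (hI0 C),
        ← Ideal.prod_normalizedFactors_eq_self (hI0 D)]
      exact congrArg Multiset.prod hFCD
    rw [← hIC C, ← hIC D, hICD]
  have hcard : classNumber K ≤ ((Finset.Icc 1 n).sigma fun a ↦ Finset.Icc 1 (n / a)).card := by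
    rw [classNumber, ← Finset.card_univ]
    refine Finset.card_le_card_of_injOn _ (fun C _ ↦ ?_) hinj.injOn
    have ha : 0 < a C := Nat.pos_of_mul_pos_right (hpos C)
    have hb : 0 < b C := Nat.pos_of_mul_pos_left (hpos C)
    have := hle C
    simp only [Finset.coe_sigma, Set.mem_sigma_iff, Finset.coe_Icc, Set.mem_Icc]
    refine ⟨⟨ha, (Nat.le_mul_of_pos_right _ hb).trans this⟩, hb, ?_⟩
    rw [Nat.le_div_iff_mul_le ha, mul_comm]
    exact this
  have hn1 : 1 ≤ n := (hpos 1).trans_le (hle 1)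
  have hnX : (n : ℝ) ≤ X := Nat.floor_le ((Real.sqrt_nonneg _).trans hX)
  have hn1' : (1 : ℝ) ≤ n := by exact_mod_cast hn1
  calc (classNumber K : ℝ) ≤ n * (1 + Real.log n) :=
        (Nat.cast_le.2 hcard).trans (Nat.card_sigma_Icc_div_le n)
    _ ≤ X * (1 + Real.log X) := by
        have := Real.log_nonneg hn1'
        have : 0 ≤ X := n.cast_nonneg.trans hnX
        gcongr

section Sqrt

variable {d : ℕ} {β : K}

open Polynomial in
theorem minpoly_eq_of_sq_eq_neg (hd : 0 < d) (hβ : β ^ 2 = -(d : K)) :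
    minpoly ℚ β = X ^ 2 + C (d : ℚ) := by
  have hmonic : (X ^ 2 + C (d : ℚ)).Monic := monic_X_pow_add_C _ two_ne_zero
  have hdeg : (X ^ 2 + C (d : ℚ)).natDegree = 2 := natDegree_X_pow_add_C
  refine (minpoly.eq_of_irreducible_of_monic ?_ ?_ hmonic).symm
  · refine irreducible_of_degree_le_three_of_not_isRoot (by rw [hdeg]; decide) fun x hx ↦ ?_
    have hd' : (0 : ℚ) < d := by exact_mod_cast hd
    simp only [IsRoot.def, eval_add, eval_pow, eval_X, eval_C] at hx
    nlinarith [sq_nonneg x]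
  · simp [hβ]

theorem exists_basis_of_sq_eq_neg (hd : 0 < d) (hβ : β ^ 2 = -(d : K))
    (htop : Algebra.adjoin ℚ {β} = ⊤) : ∃ b : Basis (Fin 2) ℚ K, ⇑b = ![1, β] := by
  have hint : IsIntegral ℚ β := .of_finite ℚ β
  let pb := PowerBasis.ofAdjoinEqTop hint htop
  have hdim : pb.dim = 2 := by
    rw [PowerBasis.ofAdjoinEqTop_dim, minpoly_eq_of_sq_eq_neg hd hβ]
    exact Polynomial.natDegree_X_pow_add_C
  refine ⟨pb.basis.reindex (finCongr hdim), ?_⟩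
  ext i
  rw [Basis.reindex_apply, pb.basis_eq_pow, PowerBasis.ofAdjoinEqTop_gen]
  fin_cases i <;> simp

theorem discr_basis_of_sq_eq_neg (hβ : β ^ 2 = -(d : K))
    (b : Basis (Fin 2) ℚ K) (hb : ⇑b = ![1, β]) : Algebra.discr ℚ b = -(4 * d) := by
  have hfr : finrank ℚ K = 2 := by simp [finrank_eq_card_basis b]
  have h1 : Algebra.trace ℚ K 1 = 2 := by
    simpa [hfr] using Algebra.trace_algebraMap (R := ℚ) (S := K) (1 : ℚ)
  have h2 : Algebra.trace ℚ K (β * β) = -(2 * d) := by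
    have := Algebra.trace_algebraMap (R := ℚ) (S := K) (-(d : ℚ))
    rw [hfr] at this
    rw [← sq, hβ]
    simpa using this
  have h3 : Algebra.trace ℚ K β = 0 := by
    have h0 : b 0 = 1 := by simp [hb]
    have h1 : b 1 = β := by simp [hb]
    have hββ : β * β = (-(d : ℚ)) • b 0 := by
      rw [← sq, hβ, h0]; simp [Algebra.smul_def]
    rw [Algebra.trace_eq_matrix_trace b, Matrix.trace_fin_two, Algebra.leftMulMatrix_eq_repr_mul,
      Algebra.leftMulMatrix_eq_repr_mul, h0, h1, hββ, mul_one, ← h1]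
    simp
  rw [Algebra.discr_def, Matrix.det_fin_two]
  simp only [Algebra.traceMatrix_apply, Algebra.traceForm_apply, hb, Matrix.cons_val_zero,
    Matrix.cons_val_one, mul_one, one_mul, h1, h2, h3]
  ring

theorem abs_discr_le_of_sq_eq_neg (hd : 0 < d) (hβ : β ^ 2 = -(d : K))
    (b : Basis (Fin 2) ℚ K) (hb : ⇑b = ![1, β]) : |discr K| ≤ 4 * d := by
  have hβint : IsIntegral ℤ β := by
    refine IsIntegral.of_pow two_pos ?_
    rw [hβ]
    simpa using isIntegral_algebraMap (R := ℤ) (A := K) (x := -(d : ℤ))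
  let e := (integralBasis K).indexEquiv b
  let c := (integralBasis K).reindex e
  have hdet : IsIntegral ℤ (c.toMatrix b).det := by
    refine IsIntegral.det fun i j ↦ ?_
    have hbj : IsIntegral ℤ (b j) := by
      fin_cases j <;> simp [hb, hβint, isIntegral_one]
    have := integralBasis_repr_apply K (⟨b j, hbj⟩ : 𝓞 K) (e.symm i)
    simp only [c, Basis.toMatrix_apply, Basis.repr_reindex_apply]
    exact (show _ = _ from this) ▸ isIntegral_algebraMap
  obtain ⟨r, hr⟩ := IsIntegrallyClosed.isIntegral_iff.1 hdet
  have h : Algebra.discr ℚ b = (r : ℚ) ^ 2 * discr K := by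
    rw [← c.toMatrix_map_vecMul b, Algebra.discr_of_matrix_vecMul, Basis.coe_reindex,
      Algebra.discr_reindex, coe_discr, ← hr]
    rfl
  rw [discr_basis_of_sq_eq_neg hβ b hb] at h
  have h' : -(4 * d : ℤ) = r ^ 2 * discr K := by exact_mod_cast h
  have hr0 : r ≠ 0 := by
    rintro rfl
    simp at h'
    omega
  have hr1 : 1 ≤ r ^ 2 := sq_pos_of_ne_zero hr0
  calc |discr K| ≤ r ^ 2 * |discr K| := le_mul_of_one_le_left (abs_nonneg _) hr1
    _ = |r ^ 2 * discr K| := by rw [abs_mul, abs_of_nonneg (sq_nonneg r)]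
    _ = 4 * d := by rw [← h', abs_neg, abs_of_nonneg (by positivity)]

/-- The class number of `ℚ(√-d)` is at most `X (1 + log X)` for `X ≥ 2 √d`. -/
theorem classNumber_le_of_sq_eq_neg (hd : 0 < d) (hβ : β ^ 2 = -(d : K))
    (htop : Algebra.adjoin ℚ {β} = ⊤) {X : ℝ} (hX : 2 * √d ≤ X) :
    (classNumber K : ℝ) ≤ X * (1 + Real.log X) := by
  obtain ⟨b, hb⟩ := exists_basis_of_sq_eq_neg hd hβ htop
  refine classNumber_le_of_finrank_eq_two (by simp [finrank_eq_card_basis b]) (le_trans ?_ hX)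
  have h : |(discr K : ℝ)| ≤ 4 * d := by
    exact_mod_cast abs_discr_le_of_sq_eq_neg hd hβ b hb
  refine (Real.sqrt_le_sqrt h).trans_eq ?_
  rw [Real.sqrt_mul (by norm_num), show (4 : ℝ) = 2 ^ 2 by norm_num, Real.sqrt_sq (by norm_num)]

end Sqrt

end NumberField

/-- If `N ≤ 4 p²` is positive and divisible by the square of some `k > (log p)²`, then `p` does
not divide the class number of `ℚ(√-N)`, provided `p` is large. -/
theorem notDvdClassNumberSqrtNeg_of_sq_dvd {p N k : ℕ} (hp : Real.exp 5 ≤ p) (hN : 0 < N)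
    (hNp : N ≤ 4 * p ^ 2) (hk : k ^ 2 ∣ N) (hlog : Real.log p ^ 2 < k) :
    NotDvdClassNumberSqrtNeg p N := by
  intro K _ _ α hα htop hdvd
  obtain ⟨d, rfl⟩ := hk
  have hd : 0 < d := Nat.pos_of_mul_pos_left hN
  have hk0 : 0 < k := by
    have : (0 : ℝ) < k := (sq_nonneg _).trans_lt hlog
    exact_mod_cast this
  have hkK : (k : K) ≠ 0 := by exact_mod_cast hk0.ne'
  have hp0 : (0 : ℝ) < p := (Real.exp_pos 5).trans_le hp
  have hL : 5 ≤ Real.log p := (Real.le_log_iff_exp_le hp0).2 hp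
  set L := Real.log p
  have hβ : (α / k) ^ 2 = -(d : K) := by
    rw [div_pow, hα]
    push_cast
    field_simp
  have htop' : Algebra.adjoin ℚ {α / (k : K)} = ⊤ := by
    rw [eq_top_iff, ← htop]
    have h : α = (k : ℚ) • (α / (k : K)) := by
      rw [Algebra.smul_def, map_natCast]
      field_simp
    refine Algebra.adjoin_le (Set.singleton_subset_iff.2 ?_)
    have := Subalgebra.smul_mem _ (Algebra.self_mem_adjoin_singleton ℚ (α / (k : K))) (k : ℚ)
    rwa [← h] at this
  have hX : 2 * √(d : ℝ) ≤ 4 * p / L ^ 2 := by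
    have h1 : (k : ℝ) * √(d : ℝ) ≤ 2 * p := by
      refine abs_le_of_sq_le_sq' ?_ (by positivity) |>.2
      rw [mul_pow, Real.sq_sqrt (by positivity)]
      have : ((k ^ 2 * d : ℕ) : ℝ) ≤ (4 * p ^ 2 : ℕ) := Nat.cast_le.2 hNp
      push_cast at this
      linarith
    rw [le_div_iff₀ (by positivity)]
    have := mul_le_mul_of_nonneg_right hlog.le (Real.sqrt_nonneg (d : ℝ))
    linarith
  have hcl := NumberField.classNumber_le_of_sq_eq_neg hd hβ htop' hX
  have hle : (p : ℝ) ≤ NumberField.classNumber K :=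
    Nat.cast_le.2 (Nat.le_of_dvd (NumberField.classNumber_pos K) hdvd)
  have hlogX : Real.log (4 * p / L ^ 2) ≤ L := by
    refine Real.log_le_log (by positivity) ?_
    rw [div_le_iff₀ (by positivity), mul_comm]
    gcongr
    nlinarith
  have hlt : 4 * p / L ^ 2 * (1 + L) < p := by
    rw [div_mul_eq_mul_div, div_lt_iff₀ (by positivity), mul_comm 4, mul_assoc]
    gcongr
    nlinarith
  have : 4 * p / L ^ 2 * (1 + Real.log (4 * p / L ^ 2)) ≤ 4 * p / L ^ 2 * (1 + L) := by
    gcongr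
  linarith

/-- There is a threshold `p₀` such that every prime `p ≥ p₀` for which `p + 2` and `p - 2`
have square factors `m², n²` with `m, n > (log p)²` divides none of the class numbers of
`ℚ(√(-p(p+2)))`, `ℚ(√(-p(p-2)))` and `ℚ(√(-(p+2)(p-2)))`. -/
theorem eventually_not_dvd_class_numbers :
    ∃ p₀ : ℝ, ∀ p : ℕ, p.Prime → p₀ ≤ p →
      (∃ m n : ℕ, 0 < m ∧ 0 < n ∧ (m : ℤ) ^ 2 ∣ (p : ℤ) + 2 ∧ (n : ℤ) ^ 2 ∣ (p : ℤ) - 2 ∧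
        Real.log p ^ 2 < m ∧ Real.log p ^ 2 < n) →
      NotDvdClassNumberSqrtNeg p (p * (p + 2)) ∧
        NotDvdClassNumberSqrtNeg p (p * (p - 2)) ∧
        NotDvdClassNumberSqrtNeg p ((p + 2) * (p - 2)) := by
  refine ⟨Real.exp 5, fun p _ hp ⟨m, n, _, _, hm, hn, hlm, hln⟩ ↦ ?_⟩
  have hp5 : 5 < p := by
    have := Real.add_one_lt_exp (x := 5) (by norm_num)
    have : (5 : ℝ) < p := by linarith
    exact_mod_cast this
  obtain ⟨q, rfl⟩ : ∃ q, p = q + 2 := ⟨p - 2, by omega⟩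
  rw [Nat.add_sub_cancel]
  have hm' : m ^ 2 ∣ q + 2 + 2 := by exact_mod_cast hm
  have hn' : n ^ 2 ∣ q := by
    have : ((q + 2 : ℕ) : ℤ) - 2 = q := by push_cast; ring
    rw [this] at hn
    exact_mod_cast hn
  have hq : 0 < q := by omega
  refine ⟨notDvdClassNumberSqrtNeg_of_sq_dvd hp (by positivity) ?_ (hm'.mul_left _) hlm,
    notDvdClassNumberSqrtNeg_of_sq_dvd hp (by positivity) ?_ (hn'.mul_left _) hln,
    notDvdClassNumberSqrtNeg_of_sq_dvd hp (by positivity) ?_ (hm'.mul_right _) hlm⟩ <;>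
  nlinarith
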